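/- arXiv:2007.04586 — 4 statements merged into one kernel-verified Lean document; each statement's English description precedes it below -/
import Mathlib

section
/- (Proposition 1, separation-constrained ECM ascent.) Let θ^s = (π^s, μ^s, v^s) be a parameter vector (π^s_k > 0 with Σ_k π^s_k = 1, v^s_k > 0) whose mean vector μ^s lies in the separation constraint set S. Define the responsibilities w_{ik} = π^s_k f(x_i; μ^s_k, v^s_k) / Σ_{l=1}^K π^s_l f(x_i; μ^s_l, v^s_l). Set π^{s+1}_k = (1/N) Σ_{i=1}^N w_{ik}; let μ^{s+1} be any element of S minimizing μ ↦ Σ_{i=1}^N Σ_{k=1}^K (w_{ik}/(2 v^s_k)) (x_i − μ_k)² over S; and set v^{s+1}_k = (Σ_{i=1}^N w_{ik} (x_i − μ^{s+1}_k)²) / (Σ_{i=1}^N w_{ik}), assuming v^{s+1}_k > 0 for every k. Then the updated parameter θ^{s+1} = (π^{s+1}, μ^{s+1}, v^{s+1}) satisfies L(θ^{s+1}) ≥ L(θ^s). -/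
/-- The one-dimensional Gaussian density `f(x; μ, v) = (2πv)^{-1/2} exp(-(x-μ)²/(2v))`. -/
noncomputable def gauss (x μ v : ℝ) : ℝ :=
  (Real.sqrt (2 * Real.pi * v))⁻¹ * Real.exp (-(x - μ) ^ 2 / (2 * v))

/-- The log-likelihood `L(θ) = Σ_i log (Σ_k π_k f(x_i; μ_k, v_k))`. -/
noncomputable def logLik (N K : ℕ) (x p μ v : ℕ → ℝ) : ℝ :=
  ∑ i ∈ Finset.range N, Real.log (∑ k ∈ Finset.range K, p k * gauss (x i) (μ k) (v k))

/-- The separation constraint set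
`S = {μ : δ_{k,1} ≤ μ_{k+1} - μ_k ≤ δ_{k,2} for k = 1, …, K-1}`. -/
def sepSet (K : ℕ) (δ1 δ2 : ℕ → ℝ) : Set (ℕ → ℝ) :=
  {μ | ∀ k, k + 1 < K → δ1 k ≤ μ (k + 1) - μ k ∧ μ (k + 1) - μ k ≤ δ2 k}

theorem gauss_pos_aux (x μ v : ℝ) (hv : 0 < v) : 0 < gauss x μ v := by
  unfold gauss
  have := Real.pi_pos
  positivity

theorem log_gauss_aux (x μ v : ℝ) (hv : 0 < v) :
    Real.log (gauss x μ v) =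
      -(1 / 2) * (Real.log (2 * Real.pi) + Real.log v) - (x - μ) ^ 2 / (2 * v) := by
  unfold gauss
  have hpi := Real.pi_pos
  have h1 : 0 < Real.sqrt (2 * Real.pi * v) := by positivity
  rw [Real.log_mul (by positivity) (by positivity), Real.log_exp, Real.log_inv,
    Real.log_sqrt (by positivity), Real.log_mul (by positivity) (by positivity)]
  ring

theorem log_diff_aux (a b : ℝ) (ha : 0 < a) (hb : 0 < b) :
    1 - a / b ≤ Real.log b - Real.log a := by
  have h := Real.log_le_sub_one_of_pos (div_pos ha hb)
  rw [Real.log_div ha.ne' hb.ne'] at h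
  linarith

theorem jensen_aux (K : ℕ) (hK : 0 < K) (a b : ℕ → ℝ) (ha : ∀ k < K, 0 < a k)
    (hb : ∀ k < K, 0 < b k) :
    ∑ k ∈ Finset.range K, a k / (∑ l ∈ Finset.range K, a l) * (Real.log (b k) - Real.log (a k))
      ≤ Real.log (∑ k ∈ Finset.range K, b k) - Real.log (∑ k ∈ Finset.range K, a k) := by
  have hne : (Finset.range K).Nonempty := ⟨0, Finset.mem_range.2 hK⟩
  have hA : 0 < ∑ l ∈ Finset.range K, a l :=
    Finset.sum_pos (fun k hk => ha k (Finset.mem_range.1 hk)) hne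
  have hB : 0 < ∑ l ∈ Finset.range K, b l :=
    Finset.sum_pos (fun k hk => hb k (Finset.mem_range.1 hk)) hne
  set A := ∑ l ∈ Finset.range K, a l with hAd
  set B := ∑ l ∈ Finset.range K, b l with hBd
  have hpt : ∀ k ∈ Finset.range K, a k / A * (Real.log (b k) - Real.log (a k)) ≤
      a k / A * (Real.log B - Real.log A) + (b k / B - a k / A) := by
    intro k hk
    have h1 := ha k (Finset.mem_range.1 hk)
    have h2 := hb k (Finset.mem_range.1 hk)
    have h := log_diff_aux (b k * A) (a k * B) (by positivity) (by positivity)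
    rw [Real.log_mul h2.ne' hA.ne', Real.log_mul h1.ne' hB.ne'] at h
    have h3 := mul_le_mul_of_nonneg_left h (div_pos h1 hA).le
    have h4 : a k / A * (1 - b k * A / (a k * B)) = a k / A - b k / B := by
      field_simp
    rw [h4] at h3
    linarith
  refine (Finset.sum_le_sum hpt).trans (le_of_eq ?_)
  rw [Finset.sum_add_distrib, Finset.sum_sub_distrib, ← Finset.sum_mul, ← Finset.sum_div,
    ← Finset.sum_div, ← hAd, ← hBd, div_self hA.ne', div_self hB.ne']
  ring

/-- Proposition 1: the separation-constrained ECM update does not decrease the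
log-likelihood. -/
theorem ecm_ascent
    (N K : ℕ) (hN : 0 < N) (hK : 0 < K)
    (x : ℕ → ℝ) (δ1 δ2 : ℕ → ℝ)
    (hδ : ∀ k, k + 1 < K → δ1 k ≤ δ2 k)
    (ps μs vs : ℕ → ℝ)
    (hps : ∀ k < K, 0 < ps k)
    (hpsum : ∑ k ∈ Finset.range K, ps k = 1)
    (hvs : ∀ k < K, 0 < vs k)
    (hμs : μs ∈ sepSet K δ1 δ2)
    (w : ℕ → ℕ → ℝ)
    (hw : ∀ i k, w i k =
      ps k * gauss (x i) (μs k) (vs k) /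
        ∑ l ∈ Finset.range K, ps l * gauss (x i) (μs l) (vs l))
    (p' μ' v' : ℕ → ℝ)
    (hp' : ∀ k, p' k = (1 / (N : ℝ)) * ∑ i ∈ Finset.range N, w i k)
    (hμ'mem : μ' ∈ sepSet K δ1 δ2)
    (hμ'min : ∀ μ ∈ sepSet K δ1 δ2,
      ∑ i ∈ Finset.range N, ∑ k ∈ Finset.range K,
          (w i k / (2 * vs k)) * (x i - μ' k) ^ 2
        ≤ ∑ i ∈ Finset.range N, ∑ k ∈ Finset.range K,
          (w i k / (2 * vs k)) * (x i - μ k) ^ 2)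
    (hv' : ∀ k, v' k =
      (∑ i ∈ Finset.range N, w i k * (x i - μ' k) ^ 2) /
        (∑ i ∈ Finset.range N, w i k))
    (hv'pos : ∀ k < K, 0 < v' k) :
    logLik N K x ps μs vs ≤ logLik N K x p' μ' v' := by
  have hne : (Finset.range K).Nonempty := ⟨0, Finset.mem_range.2 hK⟩
  have hneN : (Finset.range N).Nonempty := ⟨0, Finset.mem_range.2 hN⟩
  have hNpos : (0 : ℝ) < N := by exact_mod_cast hN
  have ha : ∀ i, ∀ k < K, 0 < ps k * gauss (x i) (μs k) (vs k) := fun i k hk =>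
    mul_pos (hps k hk) (gauss_pos_aux _ _ _ (hvs k hk))
  have hA : ∀ i, 0 < ∑ l ∈ Finset.range K, ps l * gauss (x i) (μs l) (vs l) := fun i =>
    Finset.sum_pos (fun k hk => ha i k (Finset.mem_range.1 hk)) hne
  have hwpos : ∀ i, ∀ k < K, 0 < w i k := fun i k hk => by
    rw [hw]; exact div_pos (ha i k hk) (hA i)
  have hwsum : ∀ i, ∑ k ∈ Finset.range K, w i k = 1 := fun i => by
    simp_rw [hw i]
    rw [← Finset.sum_div, div_self (hA i).ne']
  have hW : ∀ k < K, 0 < ∑ i ∈ Finset.range N, w i k := fun k hk =>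
    Finset.sum_pos (fun i _ => hwpos i k hk) hneN
  have hp'pos : ∀ k < K, 0 < p' k := fun k hk => by
    rw [hp']; exact mul_pos (by positivity) (hW k hk)
  have hWp : ∀ k, ∑ i ∈ Finset.range N, w i k = N * p' k := fun k => by
    rw [hp']; field_simp
  have hp'sum : ∑ k ∈ Finset.range K, (N : ℝ) * p' k = N := by
    simp_rw [← hWp]
    rw [Finset.sum_comm]
    simp [hwsum]
  have hb : ∀ i, ∀ k < K, 0 < p' k * gauss (x i) (μ' k) (v' k) := fun i k hk =>
    mul_pos (hp'pos k hk) (gauss_pos_aux _ _ _ (hv'pos k hk))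
  have hmain : ∑ i ∈ Finset.range N, ∑ k ∈ Finset.range K,
      w i k * ((1 - ps k / p' k) + 1 / 2 * (1 - v' k / vs k) - (x i - μ' k) ^ 2 / (2 * v' k)
        + (x i - μs k) ^ 2 / (2 * vs k)) ≤ logLik N K x p' μ' v' - logLik N K x ps μs vs := by
    unfold logLik
    rw [← Finset.sum_sub_distrib]
    refine Finset.sum_le_sum fun i _ => ?_
    refine le_trans ?_ (jensen_aux K hK _ _ (ha i) (hb i))
    refine Finset.sum_le_sum fun k hk => ?_
    have hk' := Finset.mem_range.1 hk
    rw [← hw i k]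
    refine mul_le_mul_of_nonneg_left ?_ (hwpos i k hk').le
    rw [Real.log_mul (hp'pos k hk').ne' (gauss_pos_aux _ _ _ (hv'pos k hk')).ne',
      Real.log_mul (hps k hk').ne' (gauss_pos_aux _ _ _ (hvs k hk')).ne',
      log_gauss_aux _ _ _ (hv'pos k hk'), log_gauss_aux _ _ _ (hvs k hk')]
    have h1 := log_diff_aux _ _ (hps k hk') (hp'pos k hk')
    have h2 := log_diff_aux _ _ (hv'pos k hk') (hvs k hk')
    linarith
  have hzero : ∑ i ∈ Finset.range N, ∑ k ∈ Finset.range K,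
      w i k * ((1 - ps k / p' k) + 1 / 2 * (1 - v' k / vs k) - (x i - μ' k) ^ 2 / (2 * v' k)
        + (x i - μs k) ^ 2 / (2 * vs k)) =
      (∑ i ∈ Finset.range N, ∑ k ∈ Finset.range K, (w i k / (2 * vs k)) * (x i - μs k) ^ 2)
      - ∑ i ∈ Finset.range N, ∑ k ∈ Finset.range K, (w i k / (2 * vs k)) * (x i - μ' k) ^ 2 := by
    have hk0 : ∀ k ∈ Finset.range K, ∑ i ∈ Finset.range N,
        w i k * ((1 - ps k / p' k) + 1 / 2 * (1 - v' k / vs k) - (x i - μ' k) ^ 2 / (2 * v' k)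
          + (x i - μs k) ^ 2 / (2 * vs k)) =
        ((∑ i ∈ Finset.range N, (w i k / (2 * vs k)) * (x i - μs k) ^ 2)
        - ∑ i ∈ Finset.range N, (w i k / (2 * vs k)) * (x i - μ' k) ^ 2)
        + (N * p' k - N * ps k) := by
      intro k hk
      have hk' := Finset.mem_range.1 hk
      have q1 := hp'pos k hk'
      have q2 := hv'pos k hk'
      have q3 := hvs k hk'
      have hS : ∑ i ∈ Finset.range N, w i k * (x i - μ' k) ^ 2 = N * p' k * v' k := by
        rw [hv' k, ← hWp k, mul_div_cancel₀ _ (hW k hk').ne']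
      have e1 : ∑ i ∈ Finset.range N, (w i k / (2 * vs k)) * (x i - μ' k) ^ 2
          = N * p' k * v' k / (2 * vs k) := by
        rw [← hS, Finset.sum_div]
        exact Finset.sum_congr rfl fun i _ => by ring
      have e2 : ∀ i, w i k * ((1 - ps k / p' k) + 1 / 2 * (1 - v' k / vs k)
          - (x i - μ' k) ^ 2 / (2 * v' k) + (x i - μs k) ^ 2 / (2 * vs k)) =
          w i k * ((1 - ps k / p' k) + 1 / 2 * (1 - v' k / vs k))
          - w i k * (x i - μ' k) ^ 2 / (2 * v' k) + (w i k / (2 * vs k)) * (x i - μs k) ^ 2 := by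
        intro i; ring
      simp_rw [e2]
      rw [Finset.sum_add_distrib, Finset.sum_sub_distrib, ← Finset.sum_mul, ← Finset.sum_div,
        hS, e1, hWp k]
      field_simp
      ring
    rw [Finset.sum_comm, Finset.sum_congr rfl hk0, Finset.sum_add_distrib,
      Finset.sum_sub_distrib, Finset.sum_sub_distrib, hp'sum, ← Finset.mul_sum, hpsum,
      Finset.sum_comm, Finset.sum_comm (s := Finset.range K)]
    ring
  have := hμ'min μs hμs
  linarith
end

section
/- (Q-improvement implies likelihood improvement.) Let θ^s = (π^s, μ^s, v^s) be a parameter vector with associated responsibilities w_{ik} = π^s_k f(x_i; μ^s_k, v^s_k) / Σ_{l=1}^K π^s_l f(x_i; μ^s_l, v^s_l). If a parameter vector θ' = (π', μ', v') satisfies Q(θ', θ^s) ≥ Q(θ^s, θ^s), then L(θ') ≥ L(θ^s). -/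
/-- `Q(θ, θ^s) = Σ_i Σ_k w_{ik} log(π_k f(x_i; μ_k, v_k))`, written in terms of
the responsibilities `w` of the current parameter `θ^s`. -/
noncomputable def Qfun (N K : ℕ) (x : ℕ → ℝ) (w : ℕ → ℕ → ℝ) (p μ v : ℕ → ℝ) : ℝ :=
  ∑ i ∈ Finset.range N, ∑ k ∈ Finset.range K,
    w i k * Real.log (p k * gauss (x i) (μ k) (v k))

theorem gibbs_aux (K : ℕ) (hK : 0 < K) (a b : ℕ → ℝ) (ha : ∀ k < K, 0 < a k)
    (hb : ∀ k < K, 0 < b k) :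
    ∑ k ∈ Finset.range K, a k / (∑ l ∈ Finset.range K, a l) * Real.log (b k)
      - ∑ k ∈ Finset.range K, a k / (∑ l ∈ Finset.range K, a l) * Real.log (a k)
      ≤ Real.log (∑ k ∈ Finset.range K, b k) - Real.log (∑ k ∈ Finset.range K, a k) := by
  have hne : (Finset.range K).Nonempty := ⟨0, Finset.mem_range.2 hK⟩
  have hA : 0 < ∑ l ∈ Finset.range K, a l :=
    Finset.sum_pos (fun k hk => ha k (Finset.mem_range.1 hk)) hne
  have hB : 0 < ∑ l ∈ Finset.range K, b l :=
    Finset.sum_pos (fun k hk => hb k (Finset.mem_range.1 hk)) hne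
  have h1 : ∑ k ∈ Finset.range K, a k / (∑ l ∈ Finset.range K, a l) = 1 := by
    rw [← Finset.sum_div, div_self hA.ne']
  have h2 : ∑ k ∈ Finset.range K, b k / (∑ l ∈ Finset.range K, b l) = 1 := by
    rw [← Finset.sum_div, div_self hB.ne']
  generalize (∑ l ∈ Finset.range K, a l) = A at *
  generalize (∑ l ∈ Finset.range K, b l) = B at *
  have key : ∑ k ∈ Finset.range K, (a k / A * Real.log (b k) - a k / A * Real.log (a k)
      - a k / A * (Real.log B - Real.log A)) ≤ ∑ k ∈ Finset.range K, (b k / B - a k / A) := by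
    refine Finset.sum_le_sum fun k hk => ?_
    have hak := ha k (Finset.mem_range.1 hk)
    have hbk := hb k (Finset.mem_range.1 hk)
    have h := Real.log_le_sub_one_of_pos (show 0 < (b k * A) / (a k * B) by positivity)
    rw [Real.log_div (by positivity) (by positivity), Real.log_mul hbk.ne' hA.ne',
      Real.log_mul hak.ne' hB.ne'] at h
    have h' := mul_le_mul_of_nonneg_left h (show 0 ≤ a k / A by positivity)
    have e : a k / A * ((b k * A) / (a k * B) - 1) = b k / B - a k / A := by
      field_simp
    rw [e] at h'
    linarith
  simp only [Finset.sum_sub_distrib, ← Finset.sum_mul, h1, h2] at key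
  linarith

/-- Q-improvement implies likelihood improvement:
if `Q(θ', θ^s) ≥ Q(θ^s, θ^s)` then `L(θ') ≥ L(θ^s)`. -/
theorem Q_improvement_implies_likelihood_improvement
    (N K : ℕ) (hN : 0 < N) (hK : 0 < K)
    (x : ℕ → ℝ)
    (ps μs vs : ℕ → ℝ)
    (hps : ∀ k < K, 0 < ps k)
    (hpsum : ∑ k ∈ Finset.range K, ps k = 1)
    (hvs : ∀ k < K, 0 < vs k)
    (w : ℕ → ℕ → ℝ)
    (hw : ∀ i k, w i k =
      ps k * gauss (x i) (μs k) (vs k) /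
        ∑ l ∈ Finset.range K, ps l * gauss (x i) (μs l) (vs l))
    (p' μ' v' : ℕ → ℝ)
    (hp' : ∀ k < K, 0 < p' k)
    (hpsum' : ∑ k ∈ Finset.range K, p' k = 1)
    (hv' : ∀ k < K, 0 < v' k)
    (hQ : Qfun N K x w ps μs vs ≤ Qfun N K x w p' μ' v') :
    logLik N K x ps μs vs ≤ logLik N K x p' μ' v' := by
  have ga : ∀ i, ∀ k < K, 0 < ps k * gauss (x i) (μs k) (vs k) := fun i k hk =>
    mul_pos (hps k hk) (gauss_pos_aux _ _ _ (hvs k hk))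
  have gb : ∀ i, ∀ k < K, 0 < p' k * gauss (x i) (μ' k) (v' k) := fun i k hk =>
    mul_pos (hp' k hk) (gauss_pos_aux _ _ _ (hv' k hk))
  have h := Finset.sum_le_sum (s := Finset.range N) fun i _ => gibbs_aux K hK _ _ (ga i) (gb i)
  simp only [Finset.sum_sub_distrib] at h
  simp only [Qfun, hw] at hQ
  simp only [logLik]
  linarith
end

section
/- (Equivalence of the K-means center formulation and the contiguous-partition formulation in one dimension.) Let x_1 ≤ … ≤ x_N be sorted real data with N ≥ K ≥ 1. Then the infimum over all μ_1 < μ_2 < … < μ_K of Σ_{i=1}^N min_{k=1,…,K} (x_i − μ_k)² equals the minimum, over all contiguous K-partitions of {1, …, N}, of the partition cost Σ_{j=1}^K W[b_j, b_{j+1} − 1]. -/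
/-- Mean of the data block `x_a, …, x_{b-1}` (0-based, half-open interval). -/
noncomputable def blockMean (x : ℕ → ℝ) (a b : ℕ) : ℝ :=
  (∑ i ∈ Finset.Ico a b, x i) / ((b - a : ℕ) : ℝ)

/-- Within-block sum of squares of the block `x_a, …, x_{b-1}`. -/
noncomputable def blockSS (x : ℕ → ℝ) (a b : ℕ) : ℝ :=
  ∑ i ∈ Finset.Ico a b, (x i - blockMean x a b) ^ 2

/-- `b` encodes a contiguous `m`-partition of the first `n` data points (0-based):
the `j`-th block is `{b j, …, b (j+1) - 1}`, each block nonempty. -/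
def IsContigPartition (n m : ℕ) (b : ℕ → ℕ) : Prop :=
  b 0 = 0 ∧ b m = n ∧ ∀ j < m, b j < b (j + 1)

/-- Cost of a contiguous partition: sum of within-block sums of squares. -/
noncomputable def partCost (x : ℕ → ℝ) (m : ℕ) (b : ℕ → ℕ) : ℝ :=
  ∑ j ∈ Finset.range m, blockSS x (b j) (b (j + 1))

theorem blockSS_le (x : ℕ → ℝ) (a b : ℕ) (h : a < b) (c : ℝ) :
    blockSS x a b ≤ ∑ i ∈ Finset.Ico a b, (x i - c) ^ 2 := by
  have hn : (0 : ℝ) < ((b - a : ℕ) : ℝ) := by exact_mod_cast Nat.sub_pos_of_lt h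
  have hm : ((b - a : ℕ) : ℝ) * blockMean x a b = ∑ i ∈ Finset.Ico a b, x i := by
    unfold blockMean
    field_simp
  unfold blockSS
  set m := blockMean x a b
  have key : ∑ i ∈ Finset.Ico a b, (x i - c) ^ 2 = ∑ i ∈ Finset.Ico a b, (x i - m) ^ 2
      + ((b - a : ℕ) : ℝ) * (m - c) ^ 2 := by
    have h1 : ∀ i ∈ Finset.Ico a b, (x i - c) ^ 2
        = (x i - m) ^ 2 + (2 * (m - c) * x i + (c ^ 2 - m ^ 2)) := by
      intro i _
      ring
    rw [Finset.sum_congr rfl h1, Finset.sum_add_distrib, Finset.sum_add_distrib,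
      ← Finset.mul_sum, ← hm]
    simp only [Finset.sum_const, Nat.card_Ico, nsmul_eq_mul]
    ring
  rw [key]
  have := mul_nonneg hn.le (sq_nonneg (m - c))
  linarith

theorem blockSS_single (x : ℕ → ℝ) (a : ℕ) : blockSS x a (a + 1) = 0 := by
  simp [blockSS, blockMean]

theorem partition_extend (x : ℕ → ℝ) (m t n : ℕ) (b : ℕ → ℕ) (hb : IsContigPartition t m b)
    (htn : t < n) : ∃ b', IsContigPartition n (m + 1) b' ∧
      partCost x (m + 1) b' = partCost x m b + blockSS x t n := by
  obtain ⟨h0, h1, h2⟩ := hb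
  refine ⟨fun j => if j ≤ m then b j else n, ⟨by simpa using h0, by simp, ?_⟩, ?_⟩
  · intro j hj
    rcases Nat.lt_succ_iff_lt_or_eq.mp hj with h | h
    · have h' : j ≤ m := h.le
      have h'' : j + 1 ≤ m := h
      simp only [h', h'', if_true]
      exact h2 j h
    · subst h
      simp [h1, htn]
  · unfold partCost
    rw [Finset.sum_range_succ]
    congr 1
    · apply Finset.sum_congr rfl
      intro j hj
      have hj := Finset.mem_range.mp hj
      have h' : j ≤ m := hj.le
      have h'' : j + 1 ≤ m := hj
      simp only [h', h'', if_true]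
    · simp [h1]

theorem singles_cost (x : ℕ → ℝ) (m : ℕ) : partCost x m id = 0 := by
  unfold partCost
  exact Finset.sum_eq_zero fun j _ => blockSS_single x j

theorem exists_partition_le (N : ℕ) (x : ℕ → ℝ) (hx : ∀ i j, i ≤ j → j < N → x i ≤ x j)
    (μ : ℕ → ℝ) (m : ℕ) : (∀ k l, k ≤ l → l < m → μ k ≤ μ l) →
    ∀ (n : ℕ) (d : ℕ → ℝ), m ≤ n → n ≤ N →
    (∀ i < n, ∃ k < m, d i = (x i - μ k) ^ 2) →
    (∀ i < n, ∀ k < m, d i ≤ (x i - μ k) ^ 2) →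
    ∃ b, IsContigPartition n m b ∧ partCost x m b ≤ ∑ i ∈ Finset.range n, d i := by
  induction m with
  | zero =>
    intro _ n d _ _ h1 _
    have hn : n = 0 := by
      by_contra hne
      obtain ⟨k, hk, _⟩ := h1 0 (by omega)
      omega
    subst hn
    exact ⟨id, ⟨rfl, rfl, by simp⟩, by simp [partCost]⟩
  | succ m ih =>
    intro hμ n d hmn hnN h1 h2
    have hμ' : ∀ k l, k ≤ l → l < m → μ k ≤ μ l := fun k l hkl hl => hμ k l hkl (by omega)
    have hd0 : ∀ i < n, 0 ≤ d i := by
      intro i hi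
      obtain ⟨k, _, hk⟩ := h1 i hi
      rw [hk]
      positivity
    obtain ⟨t, htn, hlt, hge⟩ : ∃ t ≤ n, (∀ i < t, ∃ k < m, d i = (x i - μ k) ^ 2) ∧
        (∀ i, t ≤ i → i < n → d i = (x i - μ m) ^ 2) := by
      have hex : ∃ t, t = n ∨ (t < n ∧ d t = (x t - μ m) ^ 2) := ⟨n, Or.inl rfl⟩
      classical
      have hs := Nat.find_spec hex
      have hmin : ∀ i, i < Nat.find hex → _ := fun i hi => Nat.find_min hex hi
      set t := Nat.find hex
      have htn : t ≤ n := by omega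
      refine ⟨t, htn, ?_, ?_⟩
      · intro i hi
        obtain ⟨k, hk, hk'⟩ := h1 i (by omega)
        have := hmin i hi
        rcases Nat.lt_succ_iff_lt_or_eq.mp hk with h | h
        · exact ⟨k, h, hk'⟩
        · subst h
          exact absurd (Or.inr ⟨by omega, hk'⟩) this
      · intro i hti hi
        rcases hs with h | ⟨_, hdt⟩
        · omega
        · apply le_antisymm (h2 i hi m (by omega))
          obtain ⟨k, hk, hk'⟩ := h1 i hi
          rw [hk']
          have a1 := h2 t (by omega) k hk
          rw [hdt] at a1
          have a2 := hμ k m (by omega) (by omega)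
          have a3 := hx t i hti (by omega)
          nlinarith [mul_nonneg (sub_nonneg.2 a2) (sub_nonneg.2 a3)]
    have split : ∀ s ≤ n, ∑ i ∈ Finset.range n, d i
        = ∑ i ∈ Finset.range s, d i + ∑ i ∈ Finset.Ico s n, d i := fun s hs =>
      (Finset.sum_range_add_sum_Ico d hs).symm
    by_cases htm : t < m
    · obtain ⟨b, hb, hc⟩ := partition_extend x m m n id ⟨rfl, rfl, fun j _ => Nat.lt_succ_self j⟩
        (by omega)
      refine ⟨b, hb, ?_⟩
      rw [hc, singles_cost, split m (by omega)]
      have e1 : 0 ≤ ∑ i ∈ Finset.range m, d i :=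
        Finset.sum_nonneg fun i hi => hd0 i (by have := Finset.mem_range.mp hi; omega)
      have e2 := blockSS_le x m n (by omega) (μ m)
      have e3 : ∑ i ∈ Finset.Ico m n, d i = ∑ i ∈ Finset.Ico m n, (x i - μ m) ^ 2 :=
        Finset.sum_congr rfl fun i hi => by
          have := Finset.mem_Ico.mp hi
          exact hge i (by omega) (by omega)
      linarith
    · by_cases htn' : t < n
      · obtain ⟨b0, hb0, hc0⟩ := ih hμ' t d (by omega) (by omega) hlt
          (fun i hi k hk => h2 i (by omega) k (by omega))
        obtain ⟨b, hb, hc⟩ := partition_extend x m t n b0 hb0 htn'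
        refine ⟨b, hb, ?_⟩
        rw [hc, split t htn]
        have e2 := blockSS_le x t n htn' (μ m)
        have e3 : ∑ i ∈ Finset.Ico t n, d i = ∑ i ∈ Finset.Ico t n, (x i - μ m) ^ 2 :=
          Finset.sum_congr rfl fun i hi => by
            have := Finset.mem_Ico.mp hi
            exact hge i (by omega) (by omega)
        linarith
      · obtain ⟨p, rfl⟩ : ∃ p, n = p + 1 := ⟨n - 1, by omega⟩
        obtain ⟨b0, hb0, hc0⟩ := ih hμ' p d (by omega) (by omega)
          (fun i hi => hlt i (by omega))
          (fun i hi k hk => h2 i (by omega) k (by omega))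
        obtain ⟨b, hb, hc⟩ := partition_extend x m p (p + 1) b0 hb0 (by omega)
        refine ⟨b, hb, ?_⟩
        rw [hc, blockSS_single, Finset.sum_range_succ]
        have := hd0 p (by omega)
        linarith

theorem partition_mono (n m : ℕ) (b : ℕ → ℕ) (hb : IsContigPartition n m b) :
    ∀ j k, j ≤ k → k ≤ m → b j ≤ b k := by
  intro j k hjk
  induction k, hjk using Nat.le_induction with
  | base => intro _; exact le_rfl
  | succ k hk ih =>
    intro h
    exact (ih (by omega)).trans (hb.2.2 k (by omega)).le

theorem partition_sum (n m : ℕ) (b : ℕ → ℕ) (hb : IsContigPartition n m b) (f : ℕ → ℝ) :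
    ∑ i ∈ Finset.range n, f i
      = ∑ j ∈ Finset.range m, ∑ i ∈ Finset.Ico (b j) (b (j + 1)), f i := by
  have : ∀ k ≤ m, ∑ i ∈ Finset.range (b k), f i
      = ∑ j ∈ Finset.range k, ∑ i ∈ Finset.Ico (b j) (b (j + 1)), f i := by
    intro k
    induction k with
    | zero => intro _; simp [hb.1]
    | succ k ih =>
      intro hk
      rw [Finset.sum_range_succ, ← ih (by omega),
        Finset.sum_range_add_sum_Ico f (hb.2.2 k (by omega)).le]
  rw [← this m le_rfl, hb.2.1]

theorem blockMean_le (x : ℕ → ℝ) (a b : ℕ) (h : a < b) (c : ℝ)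
    (hc : ∀ i, a ≤ i → i < b → x i ≤ c) : blockMean x a b ≤ c := by
  have hn : (0 : ℝ) < ((b - a : ℕ) : ℝ) := by exact_mod_cast Nat.sub_pos_of_lt h
  unfold blockMean
  rw [div_le_iff₀ hn]
  have := Finset.sum_le_card_nsmul (Finset.Ico a b) x c
    (fun i hi => hc i (Finset.mem_Ico.mp hi).1 (Finset.mem_Ico.mp hi).2)
  rw [Nat.card_Ico, nsmul_eq_mul] at this
  linarith

theorem le_blockMean (x : ℕ → ℝ) (a b : ℕ) (h : a < b) (c : ℝ)
    (hc : ∀ i, a ≤ i → i < b → c ≤ x i) : c ≤ blockMean x a b := by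
  have hn : (0 : ℝ) < ((b - a : ℕ) : ℝ) := by exact_mod_cast Nat.sub_pos_of_lt h
  unfold blockMean
  rw [le_div_iff₀ hn]
  have := Finset.card_nsmul_le_sum (Finset.Ico a b) x c
    (fun i hi => hc i (Finset.mem_Ico.mp hi).1 (Finset.mem_Ico.mp hi).2)
  rw [Nat.card_Ico, nsmul_eq_mul] at this
  linarith

theorem blockMean_mono (N K : ℕ) (x : ℕ → ℝ) (hx : ∀ i j, i ≤ j → j < N → x i ≤ x j)
    (b : ℕ → ℕ) (hb : IsContigPartition N K b) (j k : ℕ) (hjk : j < k) (hk : k < K) :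
    blockMean x (b j) (b (j + 1)) ≤ blockMean x (b k) (b (k + 1)) := by
  have h1 := partition_mono N K b hb (j + 1) k hjk hk.le
  have h2 := partition_mono N K b hb (k + 1) K hk le_rfl
  have h3 := hb.2.2 k hk
  rw [hb.2.1] at h2
  refine (blockMean_le x _ _ (hb.2.2 j (by omega)) (x (b k)) ?_).trans
    (le_blockMean x _ _ h3 (x (b k)) ?_)
  · intro i _ hi
    exact hx i _ (by omega) (by omega)
  · intro i hi hi'
    exact hx _ i hi (by omega)

theorem costs_finite (N K : ℕ) (x : ℕ → ℝ) :
    {c | ∃ b : ℕ → ℕ, IsContigPartition N K b ∧ c = partCost x K b}.Finite := by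
  apply (Set.finite_range (fun f : Fin (K + 1) → Fin (N + 1) =>
    partCost x K (fun j => if h : j < K + 1 then (f ⟨j, h⟩ : ℕ) else 0))).subset
  rintro c ⟨b, hb, rfl⟩
  have hle : ∀ j ≤ K, b j < N + 1 := by
    intro j hj
    have := partition_mono N K b hb j K hj le_rfl
    rw [hb.2.1] at this
    omega
  refine ⟨fun j => ⟨b j, hle j (by omega)⟩, ?_⟩
  unfold partCost
  apply Finset.sum_congr rfl
  intro j hj
  have hj := Finset.mem_range.mp hj
  have h' : j < K + 1 := by omega
  have h'' : j + 1 < K + 1 := by omega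
  simp only [h', h'', dif_pos]

theorem costs_nonempty (N K : ℕ) (hK : 0 < K) (hKN : K ≤ N) (x : ℕ → ℝ) :
    {c | ∃ b : ℕ → ℕ, IsContigPartition N K b ∧ c = partCost x K b}.Nonempty := by
  obtain ⟨m, rfl⟩ : ∃ m, K = m + 1 := ⟨K - 1, by omega⟩
  obtain ⟨b, hb, _⟩ := partition_extend x m m N id ⟨rfl, rfl, fun j _ => Nat.lt_succ_self j⟩
    (by omega)
  exact ⟨_, b, hb, rfl⟩

/-- Equivalence of the K-means center formulation and the contiguous-partition
formulation in one dimension: for sorted data, the infimum over strictly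
increasing centers `μ_1 < ⋯ < μ_K` of `Σ_i min_k (x_i - μ_k)²` equals the minimum
of the partition cost over contiguous `K`-partitions, and this minimum is
attained. -/
theorem kmeans_centers_eq_contiguous_partitions
    (N K : ℕ) (hK : 0 < K) (hKN : K ≤ N)
    (x : ℕ → ℝ) (hx : ∀ i j, i ≤ j → j < N → x i ≤ x j) :
    ∃ c : ℝ,
      IsLeast {c | ∃ b : ℕ → ℕ, IsContigPartition N K b ∧ c = partCost x K b} c ∧
      c = sInf {c | ∃ μ : Fin K → ℝ, StrictMono μ ∧
            c = ∑ i ∈ Finset.range N, ⨅ k : Fin K, (x i - μ k) ^ 2} := by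
  have hne := costs_nonempty N K hK hKN x
  obtain ⟨c, hcS, hcmin⟩ := (costs_finite N K x).exists_minimal hne
  have hleast : IsLeast {c | ∃ b : ℕ → ℕ, IsContigPartition N K b ∧ c = partCost x K b} c :=
    ⟨hcS, fun y hy => (le_total c y).elim id (fun h => hcmin hy h)⟩
  refine ⟨c, hleast, ?_⟩
  haveI : Nonempty (Fin K) := ⟨⟨0, hK⟩⟩
  have hbdd : ∀ (y : ℝ) (μ : Fin K → ℝ), BddBelow (Set.range fun k => (y - μ k) ^ 2) :=
    fun y μ => ⟨0, by rintro _ ⟨k, rfl⟩; positivity⟩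
  have hlow : ∀ v ∈ {c | ∃ μ : Fin K → ℝ, StrictMono μ ∧
      c = ∑ i ∈ Finset.range N, ⨅ k : Fin K, (x i - μ k) ^ 2}, c ≤ v := by
    rintro v ⟨μ, hμ, rfl⟩
    obtain ⟨b, hb, hle⟩ := exists_partition_le N x hx
      (fun k => if h : k < K then μ ⟨k, h⟩ else 0) K (by
        intro k l hkl hl
        have hk : k < K := by omega
        simp only [hk, hl, dif_pos]
        exact hμ.monotone hkl) N (fun i => ⨅ k : Fin K, (x i - μ k) ^ 2) hKN le_rfl
      (by
        intro i _
        obtain ⟨k, hk⟩ := exists_eq_ciInf_of_finite (f := fun k : Fin K => (x i - μ k) ^ 2)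
        refine ⟨k, k.2, ?_⟩
        simp only [k.2, dif_pos]
        exact hk.symm)
      (by
        intro i _ k hk
        simp only [hk, dif_pos]
        exact ciInf_le (hbdd (x i) μ) ⟨k, hk⟩)
    exact (hleast.2 ⟨b, hb, rfl⟩).trans hle
  apply le_antisymm
  · apply le_csInf _ hlow
    exact ⟨_, fun k => ((k : ℕ) : ℝ), fun a b h => by simpa using h, rfl⟩
  · obtain ⟨b, hb, hcb⟩ := hcS
    set m : ℕ → ℝ := fun j => blockMean x (b j) (b (j + 1)) with hm
    have hub : ∀ ε > (0 : ℝ), sInf {c | ∃ μ : Fin K → ℝ, StrictMono μ ∧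
        c = ∑ i ∈ Finset.range N, ⨅ k : Fin K, (x i - μ k) ^ 2} ≤
        ∑ j ∈ Finset.range K, ∑ i ∈ Finset.Ico (b j) (b (j + 1)), (x i - (m j + ε * j)) ^ 2 := by
      intro ε hε
      have hmono : StrictMono (fun k : Fin K => m k + ε * ((k : ℕ) : ℝ)) := by
        intro k l hkl
        have hkl' : (k : ℕ) < (l : ℕ) := hkl
        have h1 : m k ≤ m l := blockMean_mono N K x hx b hb k l hkl' l.2
        have h2 : ((k : ℕ) : ℝ) < ((l : ℕ) : ℝ) := by exact_mod_cast hkl'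
        have h3 := mul_lt_mul_of_pos_left h2 hε
        show m k + ε * ((k : ℕ) : ℝ) < m l + ε * ((l : ℕ) : ℝ)
        linarith
      refine (csInf_le ⟨c, hlow⟩ ⟨_, hmono, rfl⟩).trans ?_
      rw [partition_sum N K b hb]
      apply Finset.sum_le_sum
      intro j hj
      apply Finset.sum_le_sum
      intro i _
      exact ciInf_le (hbdd (x i) (fun k : Fin K => m k + ε * ((k : ℕ) : ℝ)))
        ⟨j, Finset.mem_range.mp hj⟩
    have hcont : Continuous (fun ε : ℝ => ∑ j ∈ Finset.range K,
        ∑ i ∈ Finset.Ico (b j) (b (j + 1)), (x i - (m j + ε * j)) ^ 2) := by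
      fun_prop
    have hlim := (hcont.tendsto 0).mono_left (nhdsWithin_le_nhds (s := Set.Ioi (0 : ℝ)))
    have hfin := ge_of_tendsto hlim
      (Filter.eventually_of_mem self_mem_nhdsWithin (fun ε hε => hub ε hε))
    simp only [zero_mul, add_zero] at hfin
    rw [hcb]
    exact hfin
end

section
/- (Failure of prefix-optimality under the separation constraint: the naive dynamic-programming recursion is invalid.) Let x = (−2, 1, 2, 4, 5, 6, 9, 10) and δ = 1.75. Among δ-separated contiguous 3-partitions of {1, 2, 3, 4}, the unique minimizer has blocks {1}, {2, 3}, {4} (cost 0.5); while among δ-separated contiguous 4-partitions of {1, 2, 3, 4, 5}, the unique minimizer has blocks {1}, {2}, {3, 4}, {5} (cost 2). In particular, the optimal δ-separated 4-partition of the first 5 points is not obtained by appending a final block to the optimal δ-separated 3-partition of a prefix: its third block starts at index 3, whereas the optimal 3-partition's third block starts at index 4. -/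
/-- A contiguous `m`-partition is `δ`-separated if the means of any two
consecutive blocks differ by at least `δ`. -/
def IsSeparated (x : ℕ → ℝ) (δ : ℝ) (m : ℕ) (b : ℕ → ℕ) : Prop :=
  ∀ j, j + 1 < m →
    δ ≤ blockMean x (b (j + 1)) (b (j + 2)) - blockMean x (b j) (b (j + 1))

/-- The data `x = (−2, 1, 2, 4, 5, 6, 9, 10)` (0-based). -/
noncomputable def xEx : ℕ → ℝ := fun i => [(-2 : ℝ), 1, 2, 4, 5, 6, 9, 10].getD i 0

/-- Boundaries of the 3-partition of the first 4 points with blocks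
`{1}, {2,3}, {4}` (1-based), i.e. `{0}, {1,2}, {3}` in 0-based indices. -/
def bEx16a : ℕ → ℕ := fun j => [0, 1, 3, 4].getD j 0

/-- Boundaries of the 4-partition of the first 5 points with blocks
`{1}, {2}, {3,4}, {5}` (1-based), i.e. `{0}, {1}, {2,3}, {4}` in 0-based indices. -/
def bEx16b : ℕ → ℕ := fun j => [0, 1, 2, 4, 5].getD j 0

lemma mean_one (a : ℕ) : blockMean xEx a (a + 1) = xEx a := by
  simp [blockMean]

lemma mean_two (a : ℕ) : blockMean xEx a (a + 2) = (xEx a + xEx (a + 1)) / 2 := by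
  simp [blockMean, Finset.sum_Ico_succ_top]

lemma ss_one (a : ℕ) : blockSS xEx a (a + 1) = 0 := by
  simp [blockSS, mean_one]

lemma ss_two (a : ℕ) : blockSS xEx a (a + 2) = (xEx a - xEx (a + 1)) ^ 2 / 2 := by
  rw [blockSS, mean_two]
  simp only [Finset.sum_Ico_succ_top (show a ≤ a + 1 by omega),
    Finset.sum_Ico_succ_top (le_refl a), Finset.Ico_self, Finset.sum_empty]
  ring

lemma x0 : xEx 0 = -2 := by simp [xEx]
lemma x1 : xEx 1 = 1 := by simp [xEx]
lemma x2 : xEx 2 = 2 := by simp [xEx]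
lemma x3 : xEx 3 = 4 := by simp [xEx]
lemma x4 : xEx 4 = 5 := by simp [xEx]

lemma m01 : blockMean xEx 0 1 = -2 := by rw [mean_one 0, x0]
lemma m12 : blockMean xEx 1 2 = 1 := by rw [mean_one 1, x1]
lemma m23 : blockMean xEx 2 3 = 2 := by rw [mean_one 2, x2]
lemma m34 : blockMean xEx 3 4 = 4 := by rw [mean_one 3, x3]
lemma m45 : blockMean xEx 4 5 = 5 := by rw [mean_one 4, x4]
lemma m13 : blockMean xEx 1 3 = 3 / 2 := by rw [mean_two 1, x1, x2]; norm_num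
lemma m24 : blockMean xEx 2 4 = 3 := by rw [mean_two 2, x2, x3]; norm_num
lemma m35 : blockMean xEx 3 5 = 9 / 2 := by rw [mean_two 3, x3, x4]; norm_num
lemma s02 : blockSS xEx 0 2 = 9 / 2 := by rw [ss_two 0, x0, x1]; norm_num
lemma s13 : blockSS xEx 1 3 = 1 / 2 := by rw [ss_two 1, x1, x2]; norm_num
lemma s24 : blockSS xEx 2 4 = 2 := by rw [ss_two 2, x2, x3]; norm_num

lemma costA : partCost xEx 3 bEx16a = 1 / 2 := by
  simp [partCost, Finset.sum_range_succ, bEx16a, ss_one 0, ss_one 3, s13]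

lemma costB : partCost xEx 4 bEx16b = 2 := by
  simp [partCost, Finset.sum_range_succ, bEx16b, ss_one 0, ss_one 1, ss_one 4, s24]

/-- Failure of prefix-optimality under the separation constraint: with
`x = (−2,1,2,4,5,6,9,10)` and `δ = 1.75`, the unique optimal `δ`-separated
contiguous 3-partition of the first 4 points is `{1},{2,3},{4}` (cost `0.5`),
while the unique optimal `δ`-separated contiguous 4-partition of the first 5
points is `{1},{2},{3,4},{5}` (cost `2`); the third block of the latter starts
at (1-based) index 3 whereas the third block of the former starts at index 4. -/
theorem prefix_optimality_fails_under_separation :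
    -- the 3-partition of the first 4 points
    (IsContigPartition 4 3 bEx16a ∧
     IsSeparated xEx 1.75 3 bEx16a ∧
     partCost xEx 3 bEx16a = 0.5 ∧
     (∀ b : ℕ → ℕ, IsContigPartition 4 3 b → IsSeparated xEx 1.75 3 b →
        partCost xEx 3 bEx16a ≤ partCost xEx 3 b ∧
        (partCost xEx 3 b = partCost xEx 3 bEx16a → ∀ j ≤ 3, b j = bEx16a j))) ∧
    -- the 4-partition of the first 5 points
    (IsContigPartition 5 4 bEx16b ∧
     IsSeparated xEx 1.75 4 bEx16b ∧
     partCost xEx 4 bEx16b = 2 ∧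
     (∀ b : ℕ → ℕ, IsContigPartition 5 4 b → IsSeparated xEx 1.75 4 b →
        partCost xEx 4 bEx16b ≤ partCost xEx 4 b ∧
        (partCost xEx 4 b = partCost xEx 4 bEx16b → ∀ j ≤ 4, b j = bEx16b j))) ∧
    -- the third blocks start at different indices
    bEx16b 2 = 2 ∧ bEx16a 2 = 3 ∧ bEx16b 2 ≠ bEx16a 2 := by
  refine ⟨⟨⟨rfl, rfl, by decide⟩, ?_, ?_, ?_⟩, ⟨⟨rfl, rfl, by decide⟩, ?_, ?_, ?_⟩,
    rfl, rfl, by decide⟩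
  · intro j hj
    have hj' : j < 2 := by omega
    interval_cases j <;> simp [bEx16a, m01, m13, m34] <;> norm_num
  · rw [costA]; norm_num
  · rintro b ⟨h0, h3, hlt⟩ -
    have l0 := hlt 0 (by omega)
    have l1 := hlt 1 (by omega)
    have l2 := hlt 2 (by omega)
    norm_num at l0 l1 l2
    have hc : partCost xEx 3 b = blockSS xEx (b 0) (b 1) + blockSS xEx (b 1) (b 2)
        + blockSS xEx (b 2) (b 3) := by
      simp [partCost, Finset.sum_range_succ]
    rw [costA, hc]
    have cases3 : (b 1 = 1 ∧ b 2 = 3) ∨ (b 1 = 1 ∧ b 2 = 2) ∨ (b 1 = 2 ∧ b 2 = 3) := by omega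
    rcases cases3 with ⟨h1, h2⟩ | ⟨h1, h2⟩ | ⟨h1, h2⟩
    · rw [h0, h1, h2, h3, ss_one 0, s13, ss_one 3]
      refine ⟨by norm_num, fun _ j hj => ?_⟩
      interval_cases j <;> simp [bEx16a, h0, h1, h2, h3]
    · rw [h0, h1, h2, h3, ss_one 0, ss_one 1, s24]
      exact ⟨by norm_num, fun h => by norm_num at h⟩
    · rw [h0, h1, h2, h3, s02, ss_one 2, ss_one 3]
      exact ⟨by norm_num, fun h => by norm_num at h⟩
  · intro j hj
    have hj' : j < 3 := by omega
    interval_cases j <;> simp [bEx16b, m01, m12, m24, m45] <;> norm_num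
  · exact costB
  · rintro b ⟨h0, h4, hlt⟩ hsep
    have l0 := hlt 0 (by omega)
    have l1 := hlt 1 (by omega)
    have l2 := hlt 2 (by omega)
    have l3 := hlt 3 (by omega)
    have e1 := hsep 1 (by omega)
    have e2 := hsep 2 (by omega)
    norm_num at l0 l1 l2 l3 e1 e2
    have hc : partCost xEx 4 b = blockSS xEx (b 0) (b 1) + blockSS xEx (b 1) (b 2)
        + blockSS xEx (b 2) (b 3) + blockSS xEx (b 3) (b 4) := by
      simp [partCost, Finset.sum_range_succ]
    rw [costB, hc]
    have cases4 : (b 1 = 1 ∧ b 2 = 2 ∧ b 3 = 4) ∨ (b 2 = 2 ∧ b 3 = 3) ∨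
        (b 2 = 3 ∧ b 3 = 4) := by omega
    rcases cases4 with ⟨h1, h2, h3⟩ | ⟨h2, h3⟩ | ⟨h2, h3⟩
    · rw [h0, h1, h2, h3, h4, ss_one 0, ss_one 1, s24, ss_one 4]
      refine ⟨by norm_num, fun _ j hj => ?_⟩
      interval_cases j <;> simp [bEx16b, h0, h1, h2, h3, h4]
    · have h1 : b 1 = 1 := by omega
      rw [h1, h2, h3, m12, m23] at e1
      norm_num at e1
    · rw [h2, h3, h4, m34, m45] at e2
      norm_num at e2
end
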